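/- A 3-quasi-Sasakian manifold is Ricci-flat if and only if it is 3-cosymplectic. -/

import Mathlib

/-!
An abstract (Lie–Rinehart style) algebraic model of the differential geometry of
almost contact metric 3-structures: `F` plays the role of the algebra of smooth
functions on a manifold `M` of dimension `4n+3`, and `V` plays the role of the
`F`-module of smooth vector fields, acting on `F` by derivations and carrying a
Lie bracket, a Riemannian metric `g`, and three almost contact metric structures
`(φ_α, ξ_α, η_α, g)`.
-/

noncomputable section

namespace QS3

/-- Cyclic (= even) permutations of `{0,1,2}`, modelling even permutations of `{1,2,3}`. -/
def Cyclic (a b c : Fin 3) : Prop :=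
  (a, b, c) = (0, 1, 2) ∨ (a, b, c) = (1, 2, 0) ∨ (a, b, c) = (2, 0, 1)

/-- The algebraic model of the smooth structure of a manifold: an `ℝ`-algebra `F`
of smooth functions and an `F`-module `V` of vector fields acting on `F` by
derivations and carrying the Lie bracket of vector fields. -/
class SmoothSetting (F : Type) (V : Type) [CommRing F] [Algebra ℝ F]
    [AddCommGroup V] [Module F V] where
  act : V → F → F
  bracket : V → V → V
  act_add : ∀ (X : V) (f₁ f₂ : F), act X (f₁ + f₂) = act X f₁ + act X f₂
  act_mul : ∀ (X : V) (f₁ f₂ : F), act X (f₁ * f₂) = act X f₁ * f₂ + f₁ * act X f₂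
  act_const : ∀ (X : V) (r : ℝ), act X (algebraMap ℝ F r) = 0
  act_addLeft : ∀ (X Y : V) (f : F), act (X + Y) f = act X f + act Y f
  act_smulLeft : ∀ (f : F) (X : V) (h : F), act (f • X) h = f * act X h
  bracket_antisymm : ∀ X Y : V, bracket X Y = -bracket Y X
  bracket_addLeft : ∀ X Y Z : V, bracket (X + Y) Z = bracket X Z + bracket Y Z
  bracket_act : ∀ (X Y : V) (f : F),
    act (bracket X Y) f = act X (act Y f) - act Y (act X f)
  bracket_smulRight : ∀ (X : V) (f : F) (Y : V),
    bracket X (f • Y) = f • bracket X Y + act X f • Y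
  jacobi : ∀ X Y Z : V,
    bracket X (bracket Y Z) + bracket Y (bracket Z X) + bracket Z (bracket X Y) = 0

section d

variable (F V : Type) [CommRing F] [Algebra ℝ F] [AddCommGroup V] [Module F V]
  [SmoothSetting F V]

/-- The action of a vector field on a function (directional derivative). -/
def der (X : V) (f : F) : F := SmoothSetting.act X f

/-- The Lie bracket of vector fields. -/
def lie (X Y : V) : V := SmoothSetting.bracket F X Y

/-- Exterior differential of a 1-form (with the `1/2` normalization convention,
so that `2 dθ(X,Y) = X θ(Y) - Y θ(X) - θ([X,Y])`). -/
def dOne (θ : V → F) (X Y : V) : F :=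
  (2 : ℝ)⁻¹ • (der F V X (θ Y) - der F V Y (θ X) - θ (lie F V X Y))

/-- Exterior differential of a 2-form (with the `1/3` normalization convention). -/
def dTwo (ω : V → V → F) (X Y Z : V) : F :=
  (3 : ℝ)⁻¹ • (der F V X (ω Y Z) + der F V Y (ω Z X) + der F V Z (ω X Y)
    - ω (lie F V X Y) Z - ω (lie F V Y Z) X - ω (lie F V Z X) Y)

end d

/-- An almost contact metric 3-structure on a manifold of dimension `4n+3`:
three almost contact metric structures `(φ_α, ξ_α, η_α, g)` satisfying the
quaternionic-type relations, together with a (local) orthonormal frame. -/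
class ACM3 (F V : Type) [CommRing F] [Algebra ℝ F] [AddCommGroup V] [Module F V]
    [SmoothSetting F V] where
  n : ℕ
  g : V → V → F
  phi : Fin 3 → V → V
  xi : Fin 3 → V
  eta : Fin 3 → V → F
  g_symm : ∀ X Y, g X Y = g Y X
  g_addLeft : ∀ X Y Z, g (X + Y) Z = g X Z + g Y Z
  g_smulLeft : ∀ (f : F) (X Y : V), g (f • X) Y = f * g X Y
  g_nondeg : ∀ X, (∀ Y, g X Y = 0) → X = 0
  phi_add : ∀ α (X Y : V), phi α (X + Y) = phi α X + phi α Y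
  phi_smul : ∀ α (f : F) (X : V), phi α (f • X) = f • phi α X
  eta_eq : ∀ α X, eta α X = g X (xi α)
  acm_sq : ∀ α X, phi α (phi α X) = -X + eta α X • xi α
  eta_xi : ∀ α, eta α (xi α) = 1
  compat : ∀ α X Y, g (phi α X) (phi α Y) = g X Y - eta α X * eta α Y
  quat_phi : ∀ a b c, Cyclic a b c → ∀ X, phi c X = phi a (phi b X) - eta b X • xi a
  quat_phi' : ∀ a b c, Cyclic a b c → ∀ X, phi c X = -(phi b (phi a X)) + eta a X • xi b
  quat_xi : ∀ a b c, Cyclic a b c → xi c = phi a (xi b)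
  quat_xi' : ∀ a b c, Cyclic a b c → xi c = -(phi b (xi a))
  quat_eta : ∀ a b c, Cyclic a b c → ∀ X, eta c X = eta a (phi b X)
  quat_eta' : ∀ a b c, Cyclic a b c → ∀ X, eta c X = -(eta b (phi a X))
  frame : Fin (4 * n + 3) → V
  frame_orth : ∀ i j, g (frame i) (frame j) = if i = j then 1 else 0
  frame_span : ∀ X : V, X = ∑ i, g X (frame i) • frame i

section acm

variable (F V : Type) [CommRing F] [Algebra ℝ F] [AddCommGroup V] [Module F V]
  [SmoothSetting F V] [ACM3 F V]

/-- The integer `n` (the manifold has dimension `4n+3`). -/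
def dimn : ℕ := ACM3.n F V

/-- The Riemannian metric. -/
def gm (X Y : V) : F := ACM3.g X Y

/-- The structure tensors `φ_α`. -/
def ph (α : Fin 3) (X : V) : V := ACM3.phi F α X

/-- The Reeb vector fields `ξ_α`. -/
def rxi (α : Fin 3) : V := ACM3.xi F α

/-- The 1-forms `η_α`. -/
def et (α : Fin 3) (X : V) : F := ACM3.eta α X

/-- The orthonormal frame. -/
def fr (i : Fin (4 * dimn F V + 3)) : V := ACM3.frame i

/-- The fundamental 2-form `Φ_α(X,Y) = g(X, φ_α Y)`. -/
def Phi (α : Fin 3) (X Y : V) : F := gm F V X (ph F V α Y)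

/-- The Nijenhuis torsion `[φ_α, φ_α]` of `φ_α`. -/
def Nij (α : Fin 3) (X Y : V) : V :=
  ph F V α (ph F V α (lie F V X Y)) + lie F V (ph F V α X) (ph F V α Y)
    - ph F V α (lie F V (ph F V α X) Y) - ph F V α (lie F V X (ph F V α Y))

/-- The normality tensor `N⁽¹⁾_α = [φ_α, φ_α] + 2 dη_α ⊗ ξ_α`. -/
def NOne (α : Fin 3) (X Y : V) : V :=
  Nij F V α X Y + ((2 : ℝ) • dOne F V (et F V α) X Y) • rxi F V α

/-- The structure `(φ_α, ξ_α, η_α)` is normal. -/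
def IsNormal (α : Fin 3) : Prop := ∀ X Y, NOne F V α X Y = 0

/-- A 2-form is closed. -/
def IsClosedTwo (ω : V → V → F) : Prop := ∀ X Y Z, dTwo F V ω X Y Z = 0

/-- The structure `(φ_α, ξ_α, η_α, g)` is quasi-Sasakian: normal with closed
fundamental 2-form. -/
def IsQuasiSasakian (α : Fin 3) : Prop :=
  IsNormal F V α ∧ IsClosedTwo F V (Phi F V α)

/-- `M` is 3-cosymplectic: each structure is normal with `dη_α = 0` and `dΦ_α = 0`. -/
def ThreeCosymplectic : Prop :=
  ∀ α, IsNormal F V α ∧ (∀ X Y, dOne F V (et F V α) X Y = 0) ∧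
    IsClosedTwo F V (Phi F V α)

/-- `M` is 3-α-Sasakian with constant `a ≠ 0`: each structure is normal (an
`α`-Sasakian structure) and `dη_δ = a Φ_δ`. -/
def Is3AlphaSasakianWith (a : ℝ) : Prop :=
  a ≠ 0 ∧ (∀ δ, IsNormal F V δ) ∧
    ∀ (δ : Fin 3) (X Y : V), dOne F V (et F V δ) X Y = algebraMap ℝ F a * Phi F V δ X Y

/-- A vector field is horizontal: it lies in `H = ∩_α ker η_α`. -/
def Horiz (X : V) : Prop := ∀ α, et F V α X = 0

/-- A vector field is vertical: it lies in `V = ⟨ξ₁, ξ₂, ξ₃⟩`. -/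
def InVert (X : V) : Prop :=
  ∃ p q r : F, X = p • rxi F V 0 + q • rxi F V 1 + r • rxi F V 2

/-- The distribution `E^{4m} = {X ∈ H : i_X dη_α = 0}`. -/
def InE4m (X : V) : Prop :=
  Horiz F V X ∧ ∀ (α : Fin 3) (Y : V), dOne F V (et F V α) X Y = 0

/-- The distribution `E^{4l}`: the orthogonal complement of `E^{4m}` in `H`. -/
def InE4l (X : V) : Prop :=
  Horiz F V X ∧ ∀ Y, InE4m F V Y → gm F V X Y = 0

/-- The distribution `E^{4l+3} = E^{4l} ⊕ V`. -/
def InE4l3 (X : V) : Prop :=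
  ∃ Y Z, InE4l F V Y ∧ InVert F V Z ∧ X = Y + Z

/-- The distribution `E^{4m+3} = E^{4m} ⊕ V`. -/
def InE4m3 (X : V) : Prop :=
  ∃ Y Z, InE4m F V Y ∧ InVert F V Z ∧ X = Y + Z

/-- The horizontal component `X_H = X - ∑_α η_α(X) ξ_α` of a vector field. -/
def horComp (X : V) : V := X - ∑ α : Fin 3, et F V α X • rxi F V α

/-- A vector field is basic with respect to the foliation defined by `E^{4m}`. -/
def BasicE4m (X : V) : Prop :=
  InE4l3 F V X ∧ ∀ W, InE4m F V W → InE4m F V (lie F V W X)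

/-- A vector field is basic with respect to the foliation defined by `E^{4l+3}`. -/
def BasicE4l3 (X : V) : Prop :=
  InE4m F V X ∧ ∀ W, InE4l3 F V W → InE4l3 F V (lie F V W X)

end acm

/-- A 3-quasi-Sasakian structure: each of the three almost contact metric
structures is quasi-Sasakian.  We also record, as part of the structure, the
standard structural facts established for such manifolds in the literature
(Cappelletti Montano–De Nicola–Dileo): the Reeb commutation relations
`[ξ_α, ξ_β] = c ξ_γ`, the splitting `H = E^{4l} ⊕ E^{4m}` (constancy of the
rank), the `φ_α`-invariance of both distributions, and the tensors `ψ_α`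
(equal to `φ_α` on `E^{4l+3}` and vanishing on `E^{4m}` when the rank is
`4l+3`, i.e. `c ≠ 0`; equal to `φ_α` on `E^{4l}` and vanishing on `E^{4m+3}`
when the rank is `4l+1`, i.e. `c = 0`). -/
class ThreeQS (F V : Type) [CommRing F] [Algebra ℝ F] [AddCommGroup V] [Module F V]
    [SmoothSetting F V] [ACM3 F V] where
  qs : ∀ α, IsQuasiSasakian F V α
  c : ℝ
  reeb_bracket : ∀ a b c', Cyclic a b c' →
    lie F V (rxi F V a) (rxi F V b) = algebraMap ℝ F c • rxi F V c'
  horiz_split : ∀ X, Horiz F V X → ∃ Y Z, InE4l F V Y ∧ InE4m F V Z ∧ X = Y + Z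
  phi_E4l : ∀ α X, InE4l F V X → InE4l F V (ph F V α X)
  phi_E4m : ∀ α X, InE4m F V X → InE4m F V (ph F V α X)
  psi : Fin 3 → V → V
  psi_add : ∀ α (X Y : V), psi α (X + Y) = psi α X + psi α Y
  psi_smul : ∀ α (f : F) (X : V), psi α (f • X) = f • psi α X
  psi_E4l : ∀ α X, InE4l F V X → psi α X = ph F V α X
  psi_E4m : ∀ α X, InE4m F V X → psi α X = 0
  psi_vert_of_ne : c ≠ 0 → ∀ α β, psi α (rxi F V β) = ph F V α (rxi F V β)
  psi_vert_of_eq : c = 0 → ∀ α β, psi α (rxi F V β) = 0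

section tqs

variable (F V : Type) [CommRing F] [Algebra ℝ F] [AddCommGroup V] [Module F V]
  [SmoothSetting F V] [ACM3 F V] [ThreeQS F V]

/-- The constant `c` with `[ξ_α, ξ_β] = c ξ_γ`. -/
def cc : ℝ := ThreeQS.c F V

/-- The tensors `ψ_α`. -/
def psiT (α : Fin 3) (X : V) : V := ThreeQS.psi F α X

/-- The tensors `θ_α = φ_α - ψ_α`. -/
def thetaT (α : Fin 3) (X : V) : V := ph F V α X - psiT F V α X

/-- The 2-forms `Θ_α(X,Y) = g(X, θ_α Y)`. -/
def ThetaForm (α : Fin 3) (X Y : V) : F := gm F V X (thetaT F V α Y)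

end tqs

/-- The 3-quasi-Sasakian manifold has rank `4l+3`: the constant `c` is nonzero
and the orthonormal frame is adapted to the splitting
`TM = E^{4l} ⊕ E^{4m} ⊕ ⟨ξ₁,ξ₂,ξ₃⟩` with `dim E^{4l} = 4l` (hence
`dim E^{4m} = 4m`, `m = n - l`, and the rank of the `η_α` is `4l+3`). -/
class HasRank (F V : Type) [CommRing F] [Algebra ℝ F] [AddCommGroup V] [Module F V]
    [SmoothSetting F V] [ACM3 F V] [ThreeQS F V] (l : ℕ) : Prop where
  c_ne : cc F V ≠ 0
  l_le : l ≤ dimn F V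
  frame_E4l : ∀ i : Fin (4 * dimn F V + 3), i.val < 4 * l → InE4l F V (fr F V i)
  frame_E4m : ∀ i : Fin (4 * dimn F V + 3), 4 * l ≤ i.val → i.val < 4 * dimn F V →
    InE4m F V (fr F V i)
  frame_xi : ∀ (i : Fin (4 * dimn F V + 3)) (a : Fin 3),
    i.val = 4 * dimn F V + a.val → fr F V i = rxi F V a

/-- The Levi-Civita connection of `g`: the unique torsion-free metric connection. -/
class LeviCivita (F V : Type) [CommRing F] [Algebra ℝ F] [AddCommGroup V] [Module F V]
    [SmoothSetting F V] [ACM3 F V] where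
  nabla : V → V → V
  nabla_addLeft : ∀ X Y Z : V, nabla (X + Y) Z = nabla X Z + nabla Y Z
  nabla_smulLeft : ∀ (f : F) (X Y : V), nabla (f • X) Y = f • nabla X Y
  nabla_addRight : ∀ X Y Z : V, nabla X (Y + Z) = nabla X Y + nabla X Z
  nabla_leibniz : ∀ (X : V) (f : F) (Y : V),
    nabla X (f • Y) = der F V X f • Y + f • nabla X Y
  nabla_metric : ∀ X Y Z : V,
    der F V X (gm F V Y Z) = gm F V (nabla X Y) Z + gm F V Y (nabla X Z)
  nabla_torsionFree : ∀ X Y : V, nabla X Y - nabla Y X = lie F V X Y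

section curv

variable (F V : Type) [CommRing F] [Algebra ℝ F] [AddCommGroup V] [Module F V]
  [SmoothSetting F V] [ACM3 F V] [LeviCivita F V]

/-- The Levi-Civita covariant derivative `∇_X Y`. -/
def nab (X Y : V) : V := LeviCivita.nabla F X Y

/-- The Riemannian curvature `R(X,Y)Z = ∇_X ∇_Y Z - ∇_Y ∇_X Z - ∇_{[X,Y]} Z`. -/
def Rcurv (X Y Z : V) : V :=
  nab F V X (nab F V Y Z) - nab F V Y (nab F V X Z) - nab F V (lie F V X Y) Z

/-- The Ricci tensor `Ric(X,Y) = ∑_i g(R(e_i, X)Y, e_i)`. -/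
def Ric (X Y : V) : F :=
  ∑ i, gm F V (Rcurv F V (fr F V i) X Y) (fr F V i)

/-- The scalar curvature. -/
def Scal : F := ∑ i, Ric F V (fr F V i) (fr F V i)

/-- `M` is Einstein: `Ric = a g` for a constant `a`. -/
def Einstein : Prop :=
  ∃ a : ℝ, ∀ X Y, Ric F V X Y = algebraMap ℝ F a * gm F V X Y

/-- `M` is η-Einstein: `Ric = a g + b ∑_α η_α ⊗ η_α` for constants `a, b`. -/
def EtaEinstein : Prop :=
  ∃ a b : ℝ, ∀ X Y, Ric F V X Y
    = algebraMap ℝ F a * gm F V X Y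
      + algebraMap ℝ F b * ∑ α : Fin 3, et F V α X * et F V α Y

end curv

/-- A (Koszul) linear connection on vector fields. -/
def IsConnection (F V : Type) [CommRing F] [Algebra ℝ F] [AddCommGroup V] [Module F V]
    [SmoothSetting F V] (D : V → V → V) : Prop :=
  (∀ X Y Z : V, D (X + Y) Z = D X Z + D Y Z) ∧
  (∀ (f : F) (X Y : V), D (f • X) Y = f • D X Y) ∧
  (∀ X Y Z : V, D X (Y + Z) = D X Y + D X Z) ∧
  (∀ (X : V) (f : F) (Y : V), D X (f • Y) = der F V X f • Y + f • D X Y)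

end QS3

namespace QS3

lemma Cyclic.rotate {a b c : Fin 3} (h : Cyclic a b c) : Cyclic b c a := by
  rcases h with h | h | h <;> simp only [Prod.mk.injEq] at h <;>
    obtain ⟨rfl, rfl, rfl⟩ := h <;> simp [Cyclic]

lemma exists_cyclic (a : Fin 3) : ∃ b c, Cyclic a b c := by
  fin_cases a
  · exact ⟨1, 2, by simp [Cyclic]⟩
  · exact ⟨2, 0, by simp [Cyclic]⟩
  · exact ⟨0, 1, by simp [Cyclic]⟩

lemma Cyclic.eq_or {a b c : Fin 3} (h : Cyclic a b c) (d : Fin 3) : d = a ∨ d = b ∨ d = c := by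
  simp only [Cyclic, Prod.mk.injEq] at h
  omega

section Calculus

variable {F V : Type} [CommRing F] [Algebra ℝ F] [AddCommGroup V] [Module F V]
  [SmoothSetting F V]

lemma two_mul_cancel {R : Type*} [CommRing R] [Algebra ℝ R] {x y : R} (h : 2 * x = 2 * y) :
    x = y := by
  have h2 : algebraMap ℝ R 2⁻¹ * 2 = 1 := by
    rw [← map_ofNat (algebraMap ℝ R) 2, ← map_mul]; norm_num
  linear_combination algebraMap ℝ R 2⁻¹ * h - (x - y) * h2

lemma der_add (X : V) (f h : F) : der F V X (f + h) = der F V X f + der F V X h :=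
  SmoothSetting.act_add X f h

lemma der_algebraMap (X : V) (r : ℝ) : der F V X (algebraMap ℝ F r) = 0 :=
  SmoothSetting.act_const X r

lemma der_zero (X : V) : der F V X (0 : F) = 0 := by
  simpa using der_algebraMap (F := F) X 0

lemma der_one (X : V) : der F V X (1 : F) = 0 := by
  simpa using der_algebraMap (F := F) X 1

lemma der_neg (X : V) (f : F) : der F V X (-f) = -der F V X f := by
  have h := der_add X f (-f)
  rw [add_neg_cancel, der_zero] at h
  linear_combination -h

lemma der_lie (X Y : V) (f : F) :
    der F V (lie F V X Y) f = der F V X (der F V Y f) - der F V Y (der F V X f) :=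
  SmoothSetting.bracket_act X Y f

lemma lie_jacobi (X Y Z : V) :
    lie F V X (lie F V Y Z) + lie F V Y (lie F V Z X) + lie F V Z (lie F V X Y) = 0 :=
  SmoothSetting.jacobi X Y Z

end Calculus

section AlmostContact

variable {F V : Type} [CommRing F] [Algebra ℝ F] [AddCommGroup V] [Module F V]
  [SmoothSetting F V] [ACM3 F V]

local notation "𝐠" => gm F V
local notation "φ" => ph F V
local notation "ξ" => rxi F V
local notation "η" => et F V

lemma gm_comm (X Y : V) : 𝐠 X Y = 𝐠 Y X := ACM3.g_symm X Y

lemma gm_add_left (X Y Z : V) : 𝐠 (X + Y) Z = 𝐠 X Z + 𝐠 Y Z := ACM3.g_addLeft X Y Z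

lemma gm_smul_left (f : F) (X Y : V) : 𝐠 (f • X) Y = f * 𝐠 X Y := ACM3.g_smulLeft f X Y

lemma gm_add_right (X Y Z : V) : 𝐠 X (Y + Z) = 𝐠 X Y + 𝐠 X Z := by
  rw [gm_comm, gm_add_left, gm_comm Y, gm_comm Z]

lemma gm_smul_right (f : F) (X Y : V) : 𝐠 X (f • Y) = f * 𝐠 X Y := by
  rw [gm_comm, gm_smul_left, gm_comm]

lemma gm_neg_left (X Y : V) : 𝐠 (-X) Y = -𝐠 X Y := by
  simpa using gm_smul_left (-1 : F) X Y

lemma gm_neg_right (X Y : V) : 𝐠 X (-Y) = -𝐠 X Y := by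
  simpa using gm_smul_right (-1 : F) X Y

lemma gm_sub_left (X Y Z : V) : 𝐠 (X - Y) Z = 𝐠 X Z - 𝐠 Y Z := by
  rw [sub_eq_add_neg, gm_add_left, gm_neg_left, sub_eq_add_neg]

lemma gm_sub_right (X Y Z : V) : 𝐠 X (Y - Z) = 𝐠 X Y - 𝐠 X Z := by
  rw [sub_eq_add_neg, gm_add_right, gm_neg_right, sub_eq_add_neg]

lemma gm_zero_left (X : V) : 𝐠 0 X = 0 := by
  simpa using gm_smul_left (0 : F) X X

lemma gm_zero_right (X : V) : 𝐠 X 0 = 0 := by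
  simpa using gm_smul_right (0 : F) X X

variable (F) in
lemma gm_ext {X Y : V} (h : ∀ Z, 𝐠 X Z = 𝐠 Y Z) : X = Y := by
  refine sub_eq_zero.mp (ACM3.g_nondeg (F := F) (X - Y) fun Z => ?_)
  change 𝐠 (X - Y) Z = 0
  rw [gm_sub_left, h, sub_self]

lemma gm_rxi_right (α : Fin 3) (X : V) : 𝐠 X (ξ α) = η α X := (ACM3.eta_eq α X).symm

lemma gm_rxi_left (α : Fin 3) (X : V) : 𝐠 (ξ α) X = η α X := by
  rw [gm_comm, gm_rxi_right]

lemma et_add (α : Fin 3) (X Y : V) : η α (X + Y) = η α X + η α Y := by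
  simp only [← gm_rxi_right, gm_add_left]

lemma et_smul (α : Fin 3) (f : F) (X : V) : η α (f • X) = f * η α X := by
  simp only [← gm_rxi_right, gm_smul_left]

lemma et_neg (α : Fin 3) (X : V) : η α (-X) = -η α X := by
  simp only [← gm_rxi_right, gm_neg_left]

lemma et_sub (α : Fin 3) (X Y : V) : η α (X - Y) = η α X - η α Y := by
  simp only [← gm_rxi_right, gm_sub_left]

lemma et_zero (α : Fin 3) : η α (0 : V) = 0 := by
  simp only [← gm_rxi_right, gm_zero_left]

lemma ph_add (α : Fin 3) (X Y : V) : φ α (X + Y) = φ α X + φ α Y := ACM3.phi_add α X Y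

lemma ph_smul (α : Fin 3) (f : F) (X : V) : φ α (f • X) = f • φ α X := ACM3.phi_smul α f X

lemma ph_neg (α : Fin 3) (X : V) : φ α (-X) = -φ α X := by
  simpa using ph_smul α (-1 : F) X

lemma ph_sub (α : Fin 3) (X Y : V) : φ α (X - Y) = φ α X - φ α Y := by
  rw [sub_eq_add_neg, ph_add, ph_neg, sub_eq_add_neg]

lemma ph_zero (α : Fin 3) : φ α (0 : V) = 0 := by
  simpa using ph_smul α (0 : F) (0 : V)

lemma ph_ph (α : Fin 3) (X : V) : φ α (φ α X) = -X + η α X • ξ α := ACM3.acm_sq α X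

lemma et_rxi_self (α : Fin 3) : η α (ξ α : V) = 1 := ACM3.eta_xi α

lemma gm_ph_ph (α : Fin 3) (X Y : V) : 𝐠 (φ α X) (φ α Y) = 𝐠 X Y - η α X * η α Y :=
  ACM3.compat α X Y

section Quaternionic

variable {a b c : Fin 3}

lemma ph_mul (h : Cyclic a b c) (X : V) : φ a (φ b X) = φ c X + η b X • ξ a := by
  have : φ c X = φ a (φ b X) - η b X • ξ a := ACM3.quat_phi a b c h X
  rw [this, sub_add_cancel]

lemma ph_mul' (h : Cyclic a b c) (X : V) : φ b (φ a X) = -φ c X + η a X • ξ b := by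
  have : φ c X = -(φ b (φ a X)) + η a X • ξ b := ACM3.quat_phi' a b c h X
  rw [this]; abel

lemma ph_rxi (h : Cyclic a b c) : φ a (ξ b : V) = ξ c := (ACM3.quat_xi a b c h).symm

lemma ph_rxi' (h : Cyclic a b c) : φ b (ξ a : V) = -ξ c := by
  have : (ξ c : V) = -(φ b (ξ a)) := ACM3.quat_xi' a b c h
  rw [this, neg_neg]

lemma et_ph (h : Cyclic a b c) (X : V) : η a (φ b X) = η c X := (ACM3.quat_eta a b c h X).symm

lemma et_ph' (h : Cyclic a b c) (X : V) : η b (φ a X) = -η c X := by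
  have : η c X = -(η b (φ a X)) := ACM3.quat_eta' a b c h X
  rw [this, neg_neg]

lemma et_rxi (h : Cyclic a b c) : η a (ξ b : V) = 0 := by
  have h1 : η a (ξ b : V) = -η b (ξ a) := by
    rw [← ph_rxi h.rotate.rotate, et_ph' h.rotate.rotate]
  have h2 : η b (ξ a : V) = η a (ξ b) := by rw [← gm_rxi_right, gm_rxi_left]
  apply two_mul_cancel
  linear_combination h1 - h2

lemma et_rxi' (h : Cyclic a b c) : η b (ξ a : V) = 0 := by
  rw [← gm_rxi_right, gm_rxi_left, et_rxi h]

end Quaternionic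

lemma ph_rxi_self (α : Fin 3) : φ α (ξ α : V) = 0 := by
  obtain ⟨b, c, h⟩ := exists_cyclic α
  have hsq : ∀ β, φ β (φ β (ξ β) : V) = 0 := fun β => by
    rw [ph_ph, et_rxi_self, one_smul, neg_add_cancel]
  have hself : ∀ β, φ β (ξ β : V) = η β (φ β (ξ β)) • ξ β := fun β => by
    have := ph_ph (F := F) β (φ β (ξ β) : V)
    rw [hsq, ph_zero, eq_comm, neg_add_eq_zero] at this
    exact this
  have h1 : φ α (ξ α : V) = φ c (ξ c) := by
    conv_lhs => rw [← ph_rxi h.rotate]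
    rw [ph_mul h, et_rxi h.rotate, zero_smul, add_zero]
  have h2 : η α (φ α (ξ α) : V) = 0 := by
    rw [h1, hself c, et_smul, et_rxi' h.rotate.rotate, mul_zero]
  rw [hself, h2, zero_smul]

lemma et_ph_self (α : Fin 3) (X : V) : η α (φ α X) = 0 := by
  have h := (ph_ph α (φ α X)).symm.trans (congrArg (φ α) (ph_ph (F := F) α X))
  rw [ph_add, ph_smul, ph_rxi_self, smul_zero, add_zero, ph_neg, add_eq_left] at h
  simpa [et_smul, et_rxi_self, et_zero] using congrArg (η α) h

lemma gm_ph_left (α : Fin 3) (X Y : V) : 𝐠 (φ α X) Y = -𝐠 X (φ α Y) := by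
  have h := gm_ph_ph (F := F) α X (φ α Y)
  rw [ph_ph, gm_add_right, gm_neg_right, gm_smul_right, gm_rxi_right, et_ph_self,
    et_ph_self] at h
  linear_combination -h

lemma et_rxi_of_ne {α β : Fin 3} (h : α ≠ β) : η α (ξ β : V) = 0 := by
  obtain ⟨b, c, hc⟩ := exists_cyclic α
  obtain rfl | rfl | rfl := hc.eq_or β
  · exact absurd rfl h
  · exact et_rxi hc
  · exact et_rxi' hc.rotate.rotate

lemma horiz_horComp (X : V) : Horiz F V (horComp F V X) := fun β => by
  fin_cases β <;>
    simp [horComp, Fin.sum_univ_three, et_sub, et_add, et_smul, et_rxi_self, et_rxi_of_ne]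

lemma gm_sum_left {ι : Type*} (s : Finset ι) (u : ι → V) (X : V) :
    𝐠 (∑ i ∈ s, u i) X = ∑ i ∈ s, 𝐠 (u i) X :=
  map_sum (⟨⟨(𝐠 · X), gm_zero_left X⟩, (gm_add_left · · X)⟩ : V →+ F) u s

variable (F) in
lemma eq_sum_fr (X : V) : X = ∑ i, 𝐠 X (fr F V i) • fr F V i := ACM3.frame_span X

lemma sum_bilin_ph_ph (T : V →ₗ[F] V →ₗ[F] F) (α : Fin 3) :
    ∑ i, T (φ α (fr F V i)) (φ α (fr F V i)) = ∑ i, T (fr F V i) (fr F V i) - T (ξ α) (ξ α) := by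
  have h1 : ∀ i, T (φ α (fr F V i)) (φ α (fr F V i)) =
      ∑ j, -(𝐠 (φ α (fr F V j)) (fr F V i) * T (fr F V j) (φ α (fr F V i))) := fun i => by
    conv_lhs => enter [1]; rw [eq_sum_fr F (φ α (fr F V i))]
    simp only [map_sum, map_smul, LinearMap.sum_apply, LinearMap.smul_apply, smul_eq_mul]
    refine Finset.sum_congr rfl fun j _ => ?_
    rw [gm_ph_left, gm_comm]; ring
  have h2 : ∀ j, T (fr F V j) (φ α (φ α (fr F V j))) =
      ∑ i, 𝐠 (φ α (fr F V j)) (fr F V i) * T (fr F V j) (φ α (fr F V i)) := fun j => by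
    let L : V →ₗ[F] F := T (fr F V j) ∘ₗ ⟨⟨φ α, ph_add α⟩, ph_smul α⟩
    change L (φ α (fr F V j)) = ∑ i, 𝐠 (φ α (fr F V j)) (fr F V i) * L (fr F V i)
    conv_lhs => rw [eq_sum_fr F (φ α (fr F V j))]
    simp only [map_sum, map_smul, smul_eq_mul]
  have h3 : ∑ j, η α (fr F V j) * T (fr F V j) (ξ α) = T (ξ α) (ξ α) := by
    conv_rhs => enter [1]; rw [eq_sum_fr F (ξ α)]
    simp only [map_sum, map_smul, LinearMap.sum_apply, LinearMap.smul_apply, smul_eq_mul,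
      gm_rxi_left]
  simp only [h1]
  rw [Finset.sum_comm]
  simp only [Finset.sum_neg_distrib, ← h2, ph_ph, map_add, map_neg, map_smul, smul_eq_mul,
    Finset.sum_add_distrib, h3]
  ring

end AlmostContact

section Connection

variable (F V : Type) [CommRing F] [Algebra ℝ F] [AddCommGroup V] [Module F V]
  [SmoothSetting F V] [ACM3 F V] [LeviCivita F V]

/-- The covariant derivative `(∇_X φ_α) Y`. -/
def nabPh (α : Fin 3) (X Y : V) : V := nab F V X (ph F V α Y) - ph F V α (nab F V X Y)

/-- The covariant derivative `∇_X ξ_α`. -/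
def nabXi (α : Fin 3) (X : V) : V := nab F V X (rxi F V α)

/-- The second covariant derivative `∇²_{X,Y} ξ_α`. -/
def nabNabXi (α : Fin 3) (X Y : V) : V :=
  nab F V X (nabXi F V α Y) - nabXi F V α (nab F V X Y)

end Connection

section LeviCivitaConnection

variable {F V : Type} [CommRing F] [Algebra ℝ F] [AddCommGroup V] [Module F V]
  [SmoothSetting F V] [ACM3 F V] [LeviCivita F V]

local notation "𝐠" => gm F V
local notation "φ" => ph F V
local notation "ξ" => rxi F V
local notation "η" => et F V
local notation "𝐃" => nab F V
local notation "𝐁" => nabXi F V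
local notation "𝐏" => nabPh F V
local notation "𝐐" => nabNabXi F V
local notation "𝐑" => Rcurv F V

lemma nab_add_left (X Y Z : V) : 𝐃 (X + Y) Z = 𝐃 X Z + 𝐃 Y Z := LeviCivita.nabla_addLeft X Y Z

lemma nab_smul_left (f : F) (X Y : V) : 𝐃 (f • X) Y = f • 𝐃 X Y :=
  LeviCivita.nabla_smulLeft f X Y

lemma nab_neg_left (X Y : V) : 𝐃 (-X) Y = -𝐃 X Y := by
  simpa using nab_smul_left (-1 : F) X Y

lemma nab_sub_left (X Y Z : V) : 𝐃 (X - Y) Z = 𝐃 X Z - 𝐃 Y Z := by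
  rw [sub_eq_add_neg, nab_add_left, nab_neg_left, sub_eq_add_neg]

lemma nab_add_right (X Y Z : V) : 𝐃 X (Y + Z) = 𝐃 X Y + 𝐃 X Z := LeviCivita.nabla_addRight X Y Z

lemma nab_smul_right (X : V) (f : F) (Y : V) : 𝐃 X (f • Y) = der F V X f • Y + f • 𝐃 X Y :=
  LeviCivita.nabla_leibniz X f Y

lemma nab_zero_right (X : V) : 𝐃 X 0 = 0 := by
  simpa using nab_add_right (F := F) X 0 0

lemma nab_neg_right (X Y : V) : 𝐃 X (-Y) = -𝐃 X Y := by
  refine eq_neg_of_add_eq_zero_left ?_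
  rw [← nab_add_right, neg_add_cancel, nab_zero_right]

lemma nab_sub_right (X Y Z : V) : 𝐃 X (Y - Z) = 𝐃 X Y - 𝐃 X Z := by
  rw [sub_eq_add_neg, nab_add_right, nab_neg_right, sub_eq_add_neg]

lemma nab_algebraMap_smul (X : V) (r : ℝ) (Y : V) :
    𝐃 X (algebraMap ℝ F r • Y) = algebraMap ℝ F r • 𝐃 X Y := by
  rw [nab_smul_right, der_algebraMap, zero_smul, zero_add]

lemma der_gm (X Y Z : V) : der F V X (𝐠 Y Z) = 𝐠 (𝐃 X Y) Z + 𝐠 Y (𝐃 X Z) :=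
  LeviCivita.nabla_metric X Y Z

variable (F) in
lemma lie_eq (X Y : V) : lie F V X Y = 𝐃 X Y - 𝐃 Y X :=
  (LeviCivita.nabla_torsionFree X Y).symm

lemma der_et (α : Fin 3) (X Y : V) : der F V X (η α Y) = η α (𝐃 X Y) + 𝐠 Y (𝐁 α X) := by
  rw [← gm_rxi_right, der_gm, gm_rxi_right]; rfl

lemma nabXi_add (α : Fin 3) (X Y : V) : 𝐁 α (X + Y) = 𝐁 α X + 𝐁 α Y := nab_add_left _ _ _

lemma nabXi_smul (α : Fin 3) (f : F) (X : V) : 𝐁 α (f • X) = f • 𝐁 α X := nab_smul_left _ _ _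

lemma nabXi_neg (α : Fin 3) (X : V) : 𝐁 α (-X) = -𝐁 α X := nab_neg_left _ _

lemma nabXi_sub (α : Fin 3) (X Y : V) : 𝐁 α (X - Y) = 𝐁 α X - 𝐁 α Y := nab_sub_left _ _ _

lemma nabPh_smul_left (α : Fin 3) (f : F) (X Y : V) : 𝐏 α (f • X) Y = f • 𝐏 α X Y := by
  simp only [nabPh, nab_smul_left, ph_smul, smul_sub]

lemma nabPh_zero_left (α : Fin 3) (X : V) : 𝐏 α 0 X = 0 := by
  simpa using nabPh_smul_left α (0 : F) X X

lemma gm_nabPh_skew (α : Fin 3) (X Y Z : V) : 𝐠 (𝐏 α X Y) Z = -𝐠 (𝐏 α X Z) Y := by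
  have h := congrArg (der F V X) (gm_ph_left (F := F) α Y Z)
  rw [der_neg, der_gm, der_gm] at h
  simp only [nabPh, gm_sub_left]
  have h1 := gm_ph_left (F := F) α Y (𝐃 X Z)
  have h2 := gm_ph_left (F := F) α (𝐃 X Y) Z
  rw [gm_comm (𝐃 X (φ α Z)), gm_comm (φ α (𝐃 X Z))]
  linear_combination h - h1 - h2

lemma et_nabXi_self (α : Fin 3) (X : V) : η α (𝐁 α X) = 0 := by
  have h := congrArg (der F V X) (et_rxi_self (F := F) (V := V) α)
  rw [der_one, der_et, gm_rxi_left] at h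
  apply two_mul_cancel
  have h1 : η α (𝐃 X (ξ α)) = η α (𝐁 α X) := rfl
  linear_combination h - h1

lemma nabPh_rxi_self (α : Fin 3) (X : V) : 𝐏 α X (ξ α) = -φ α (𝐁 α X) := by
  simp only [nabPh, ph_rxi_self, nab_zero_right, zero_sub]; rfl

lemma nabPh_ph (α : Fin 3) (X Y : V) :
    𝐏 α X (φ α Y) = -φ α (𝐏 α X Y) + 𝐠 Y (𝐁 α X) • ξ α + η α Y • 𝐁 α X := by
  have h : 𝐃 X (ξ α) = 𝐁 α X := rfl
  simp only [nabPh, ph_ph, nab_add_right, nab_neg_right, nab_smul_right, ph_sub, der_et, h]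
  module

lemma two_mul_dOne_et (α : Fin 3) (X Y : V) :
    2 * dOne F V (η α) X Y = 𝐠 (𝐁 α X) Y - 𝐠 (𝐁 α Y) X := by
  have h2 : 2 * algebraMap ℝ F 2⁻¹ = 1 := by
    rw [← map_ofNat (algebraMap ℝ F) 2, ← map_mul]; norm_num
  rw [dOne, Algebra.smul_def, ← mul_assoc, h2, one_mul, der_et, der_et, lie_eq F, et_sub,
    gm_comm Y, gm_comm X]
  ring

lemma three_mul_dTwo_Phi (α : Fin 3) (X Y Z : V) :
    3 * dTwo F V (Phi F V α) X Y Z =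
      𝐠 (𝐏 α X Z) Y + 𝐠 (𝐏 α Y X) Z + 𝐠 (𝐏 α Z Y) X := by
  have h3 : 3 * algebraMap ℝ F 3⁻¹ = 1 := by
    rw [← map_ofNat (algebraMap ℝ F) 3, ← map_mul]; norm_num
  rw [dTwo, Algebra.smul_def, ← mul_assoc, h3, one_mul]
  simp only [Phi, der_gm, lie_eq F, nabPh, gm_sub_left, gm_ph_left]
  rw [gm_comm (𝐃 X (φ α Z)), gm_comm (𝐃 Y (φ α X)), gm_comm (𝐃 Z (φ α Y))]
  ring

lemma NOne_eq (α : Fin 3) (X Y : V) :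
    NOne F V α X Y = 𝐏 α (φ α X) Y - 𝐏 α (φ α Y) X + φ α (𝐏 α Y X) - φ α (𝐏 α X Y)
      + (𝐠 (𝐁 α X) Y - 𝐠 (𝐁 α Y) X) • ξ α := by
  have h2 : (2 : ℝ) • dOne F V (η α) X Y = 𝐠 (𝐁 α X) Y - 𝐠 (𝐁 α Y) X := by
    rw [← two_mul_dOne_et, Algebra.smul_def, map_ofNat]
  simp only [NOne, h2, Nij, lie_eq, nabPh, ph_sub]
  abel

section QuasiSasakian

variable {α : Fin 3}

lemma cyclic_sum_nabPh (hα : IsQuasiSasakian F V α) (X Y Z : V) :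
    𝐠 (𝐏 α X Y) Z + 𝐠 (𝐏 α Y Z) X + 𝐠 (𝐏 α Z X) Y = 0 := by
  have h := three_mul_dTwo_Phi (F := F) α X Y Z
  rw [hα.2, mul_zero] at h
  have hs := gm_nabPh_skew (F := F) (V := V) α
  linear_combination h + hs X Y Z + hs Y Z X + hs Z X Y

lemma normal_nabPh (hα : IsQuasiSasakian F V α) (X Y Z : V) :
    𝐠 (𝐏 α (φ α X) Y) Z - 𝐠 (𝐏 α (φ α Y) X) Z - 𝐠 (𝐏 α Y X) (φ α Z) + 𝐠 (𝐏 α X Y) (φ α Z)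
      + (𝐠 (𝐁 α X) Y - 𝐠 (𝐁 α Y) X) * η α Z = 0 := by
  have h := congrArg (𝐠 · Z) ((NOne_eq (F := F) α X Y).symm.trans (hα.1 X Y))
  simp only [gm_add_left, gm_sub_left, gm_smul_left, gm_rxi_left, gm_ph_left, gm_zero_left] at h
  linear_combination h

lemma gm_nabPh_rxi_left (α : Fin 3) (X Z : V) :
    𝐠 (𝐏 α X (ξ α)) Z = 𝐠 (𝐁 α X) (φ α Z) := by
  rw [nabPh_rxi_self, gm_neg_left, gm_ph_left, neg_neg]

lemma et_nabPh (α : Fin 3) (X Y : V) : η α (𝐏 α X Y) = -𝐠 (𝐁 α X) (φ α Y) := by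
  rw [← gm_rxi_right, gm_nabPh_skew, gm_nabPh_rxi_left]

lemma nabXi_rxi_self (hα : IsQuasiSasakian F V α) : 𝐁 α (ξ α : V) = 0 := by
  refine gm_ext F fun X => ?_
  have h := normal_nabPh hα X (ξ α) (ξ α)
  simp only [ph_rxi_self, gm_zero_right, et_rxi_self, gm_rxi_right, et_nabXi_self, et_nabPh,
    nabPh_zero_left, et_zero] at h
  rw [gm_zero_left]
  linear_combination -h

/-- The Reeb vector field of a quasi-Sasakian structure is Killing. -/
lemma gm_nabXi_skew (hα : IsQuasiSasakian F V α) (X Y : V) :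
    𝐠 (𝐁 α X) Y = -𝐠 X (𝐁 α Y) := by
  have key : ∀ X Y : V, 𝐠 (𝐁 α (φ α X)) (φ α Y) = -𝐠 (𝐁 α (φ α Y)) (φ α X) := fun X Y => by
    have h1 := normal_nabPh hα (ξ α) X Y
    have h2 := cyclic_sum_nabPh hα (ξ α) X (φ α Y)
    simp only [ph_rxi_self, gm_rxi_right, et_nabXi_self, et_nabPh, nabPh_zero_left,
      gm_nabPh_rxi_left, nabXi_rxi_self hα, gm_zero_left] at h1 h2
    linear_combination h2 - h1
  have h := key (φ α X) (φ α Y)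
  simp only [ph_ph, nabXi_add, nabXi_neg, nabXi_smul, nabXi_rxi_self hα, smul_zero, add_zero,
    gm_add_right, gm_neg_left, gm_neg_right, gm_smul_right, gm_rxi_right, et_neg, et_nabXi_self] at h
  rw [gm_comm X]
  linear_combination h

lemma nabXi_ph (hα : IsQuasiSasakian F V α) (X : V) : 𝐁 α (φ α X) = φ α (𝐁 α X) := by
  have key : ∀ Y : V, 𝐠 (𝐁 α X) Y = 𝐠 (𝐁 α (φ α X)) (φ α Y) := fun Y => by
    have h := normal_nabPh hα X Y (ξ α)
    simp only [ph_rxi_self, gm_zero_right, et_rxi_self, gm_rxi_right, et_nabPh] at h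
    apply two_mul_cancel
    have h1 := gm_nabXi_skew hα Y X
    have h2 := gm_nabXi_skew hα (φ α Y) (φ α X)
    rw [gm_comm Y] at h1
    rw [gm_comm (φ α Y)] at h2
    linear_combination h + h1 - h2
  refine gm_ext F fun Z => ?_
  have h := key (φ α Z)
  simp only [ph_ph, gm_add_right, gm_neg_right, gm_smul_right, gm_rxi_right, et_nabXi_self] at h
  rw [gm_ph_left]
  linear_combination h

lemma gm_ph_nabXi (hα : IsQuasiSasakian F V α) (X Y : V) :
    𝐠 X (φ α (𝐁 α Y)) = -𝐠 (𝐁 α X) (φ α Y) := by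
  rw [← nabXi_ph hα, gm_nabXi_skew hα, neg_neg]

lemma gm_nabXi_ph_comm (hα : IsQuasiSasakian F V α) (X Y : V) :
    𝐠 (𝐁 α X) (φ α Y) = 𝐠 (𝐁 α Y) (φ α X) := by
  rw [← neg_neg (𝐠 (𝐁 α X) (φ α Y)), ← gm_ph_nabXi hα, gm_comm, gm_ph_left, neg_neg]

lemma nabPh_eq (hα : IsQuasiSasakian F V α) (X Y : V) :
    𝐏 α X Y = 𝐠 (𝐁 α (φ α Y)) X • ξ α - η α Y • φ α (𝐁 α X) := by
  refine gm_ext F fun Z => two_mul_cancel ?_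
  have h1 := cyclic_sum_nabPh hα X Y Z
  have h2 := cyclic_sum_nabPh hα X (φ α Y) (φ α Z)
  have h3 := normal_nabPh hα Y Z (φ α X)
  have h4 := gm_nabPh_skew (F := F) α (φ α Z) X (φ α Y)
  have h5 := gm_nabPh_skew (F := F) α Z X Y
  simp only [nabPh_ph, ph_ph, gm_add_left, gm_add_right, gm_neg_left, gm_neg_right, gm_smul_left,
    gm_smul_right, gm_sub_left, gm_rxi_left, gm_rxi_right, gm_ph_left, et_ph_self, et_nabPh,
    nabXi_ph hα, gm_ph_nabXi hα] at *
  have hs := gm_nabXi_ph_comm hα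
  linear_combination h1 - h2 + h3 + h4 - h5 - η α Z * hs X Y - η α Y * hs X Z
    + 2 * η α X * hs Y Z

end QuasiSasakian

section Curvature

lemma Rcurv_antisymm (X Y Z : V) : 𝐑 X Y Z = -𝐑 Y X Z := by
  simp only [Rcurv, lie_eq F, nab_sub_left]; abel

lemma Rcurv_bianchi (X Y Z : V) : 𝐑 X Y Z + 𝐑 Y Z X + 𝐑 Z X Y = 0 := by
  have h := lie_jacobi (F := F) X Y Z
  simp only [lie_eq F, nab_sub_left, nab_sub_right] at h
  simp only [Rcurv, lie_eq F, nab_sub_left]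
  rw [← h]; abel

lemma gm_Rcurv_skew (X Y Z W : V) : 𝐠 (𝐑 X Y Z) W = -𝐠 (𝐑 X Y W) Z := by
  have h := der_lie X Y (𝐠 Z W)
  simp only [der_gm, der_add] at h
  simp only [Rcurv, gm_sub_left]
  rw [gm_comm _ Z, gm_comm _ Z, gm_comm _ Z]
  linear_combination -h

lemma gm_Rcurv_pair_comm (X Y Z W : V) : 𝐠 (𝐑 X Y Z) W = 𝐠 (𝐑 Z W X) Y := by
  have anti : ∀ X Y Z W : V, 𝐠 (𝐑 X Y Z) W = -𝐠 (𝐑 Y X Z) W := fun X Y Z W => by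
    rw [Rcurv_antisymm, gm_neg_left]
  have bianchi : ∀ X Y Z W : V,
      𝐠 (𝐑 X Y Z) W + 𝐠 (𝐑 Y Z X) W + 𝐠 (𝐑 Z X Y) W = 0 := fun X Y Z W => by
    rw [← gm_add_left, ← gm_add_left, Rcurv_bianchi, gm_zero_left]
  have skew := gm_Rcurv_skew (F := F) (V := V)
  apply two_mul_cancel
  linear_combination bianchi X Y Z W + bianchi Y Z W X - bianchi Z W X Y - bianchi W X Y Z
    - skew Y Z X W - skew Z W Y X + skew W X Z Y + skew X Y W Z + skew X Z W Y - anti X Z Y W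
    + skew Y W X Z - anti Y W Z X

lemma gm_Rcurv_eq_neg (X Y Z W : V) : 𝐠 (𝐑 X Y Z) W = -𝐠 (𝐑 Z W Y) X := by
  rw [gm_Rcurv_pair_comm, gm_Rcurv_skew]

lemma Rcurv_rxi (α : Fin 3) (X Y : V) : 𝐑 X Y (ξ α) = 𝐐 α X Y - 𝐐 α Y X := by
  simp only [Rcurv, nabNabXi, lie_eq F, nab_sub_left, nabXi]; abel

variable {α : Fin 3}

lemma gm_nabNabXi_skew (hα : IsQuasiSasakian F V α) (X Y Z : V) :
    𝐠 (𝐐 α X Y) Z = -𝐠 (𝐐 α X Z) Y := by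
  have h := congrArg (der F V X) (gm_nabXi_skew hα Y Z)
  rw [der_neg, der_gm, der_gm] at h
  have h1 := gm_nabXi_skew hα Y (𝐃 X Z)
  have h2 := gm_nabXi_skew hα (𝐃 X Y) Z
  simp only [nabNabXi, gm_sub_left]
  rw [gm_comm (𝐃 X (𝐁 α Z)), gm_comm (𝐁 α (𝐃 X Z))]
  linear_combination h - h1 - h2

lemma gm_nabNabXi_eq (hα : IsQuasiSasakian F V α) (X Y Z : V) :
    𝐠 (𝐐 α Z X) Y = 𝐠 (𝐐 α Y X) Z - 𝐠 (𝐐 α X Y) Z := by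
  have hR := Rcurv_bianchi (F := F) X Y Z
  have h := congrArg (𝐠 · (ξ α)) hR
  simp only [gm_add_left, gm_zero_left] at h
  rw [gm_Rcurv_skew X Y, gm_Rcurv_skew Y Z, gm_Rcurv_skew Z X] at h
  simp only [Rcurv_rxi, gm_sub_left] at h
  have hs := gm_nabNabXi_skew hα
  apply two_mul_cancel
  linear_combination -h + hs X Y Z + hs Z X Y - hs Y X Z

end Curvature

section ThreeQuasiSasakian

variable [ThreeQS F V] {a b c : Fin 3}

local notation "κ" => algebraMap ℝ F (cc F V / 2)

lemma nabXi_eq_ph_nabXi (h : Cyclic a b c) (X : V) :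
    𝐁 c X = φ a (𝐁 b X) + 𝐠 (𝐁 a (ξ c)) X • ξ a := by
  have h1 := nabPh_eq (F := F) (V := V) (ThreeQS.qs a) X (ξ b)
  rw [ph_rxi h, et_rxi h, zero_smul, sub_zero, nabPh, ph_rxi h] at h1
  rw [← h1]
  simp only [nabXi]; abel

lemma nabXi_eq_neg_ph_nabXi (h : Cyclic a b c) (X : V) :
    𝐁 c X = 𝐠 (𝐁 b (ξ c)) X • ξ b - φ b (𝐁 a X) := by
  have h1 := nabPh_eq (F := F) (V := V) (ThreeQS.qs b) X (ξ a)
  rw [ph_rxi' h, et_rxi' h, zero_smul, sub_zero, nabPh, ph_rxi' h, nab_neg_right, nabXi_neg,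
    gm_neg_left, neg_smul] at h1
  rw [← neg_eq_iff_eq_neg.mpr h1]
  simp only [nabXi]; abel

lemma et_nabXi_rxi (h : Cyclic a b c) : η a (𝐁 c (ξ b : V)) = κ := by
  have key : ∀ {a b c : Fin 3}, Cyclic a b c →
      𝐁 c (ξ b : V) = η b (𝐁 a (ξ c : V)) • (ξ a : V) := fun {a b c} h => by
    have := nabXi_eq_ph_nabXi (F := F) (V := V) h (ξ b)
    rwa [nabXi_rxi_self (ThreeQS.qs b), ph_zero, zero_add, gm_rxi_right] at this
  have t2 := congrArg (η c) (key h.rotate.rotate)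
  rw [et_smul, et_rxi_self, mul_one] at t2
  have t3 := gm_nabXi_skew (F := F) (V := V) (ThreeQS.qs b) (ξ c) (ξ a)
  rw [gm_rxi_right, gm_rxi_left] at t3
  have hb := congrArg (η a) (ThreeQS.reeb_bracket (F := F) (V := V) b c a h.rotate)
  rw [lie_eq F, et_sub, et_smul, et_rxi_self] at hb
  have hk : 2 * κ = algebraMap ℝ F (ThreeQS.c F V) := by
    rw [← map_ofNat (algebraMap ℝ F) 2, ← map_mul, cc]; congr 1; ring
  change η a (𝐁 c (ξ b)) - η a (𝐁 b (ξ c)) = _ at hb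
  apply two_mul_cancel
  linear_combination hb - hk + t3 - t2

lemma nabXi_rxi' (h : Cyclic a b c) : 𝐁 c (ξ b : V) = κ • (ξ a : V) := by
  rw [nabXi_eq_ph_nabXi h (ξ b), nabXi_rxi_self (ThreeQS.qs b), ph_zero, zero_add, gm_rxi_right,
    et_nabXi_rxi h.rotate]

lemma nabXi_rxi (h : Cyclic a b c) : 𝐁 c (ξ a : V) = -κ • (ξ b : V) := by
  rw [nabXi_eq_neg_ph_nabXi h (ξ a), nabXi_rxi_self (ThreeQS.qs a), ph_zero, sub_zero,
    gm_nabXi_skew (ThreeQS.qs b), gm_rxi_left, et_nabXi_rxi h.rotate.rotate]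

lemma ph_nabXi (h : Cyclic a b c) (X : V) :
    φ a (𝐁 b X) = 𝐁 c X - (κ * η b X) • ξ a := by
  rw [nabXi_eq_ph_nabXi h X, nabXi_rxi' h.rotate, gm_smul_left, gm_rxi_left]; abel

lemma ph_nabXi' (h : Cyclic a b c) (X : V) :
    φ b (𝐁 a X) = -𝐁 c X - (κ * η a X) • ξ b := by
  rw [nabXi_eq_neg_ph_nabXi h X, nabXi_rxi h.rotate.rotate, gm_smul_left, gm_rxi_left]; module

lemma et_nabXi (h : Cyclic a b c) (X : V) : η b (𝐁 c X) = -(κ * η a X) := by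
  rw [← gm_rxi_right, gm_nabXi_skew (ThreeQS.qs c), nabXi_rxi' h, gm_smul_right, gm_rxi_right]

lemma et_nabXi' (h : Cyclic a b c) (X : V) : η a (𝐁 c X) = κ * η b X := by
  rw [← gm_rxi_right, gm_nabXi_skew (ThreeQS.qs c), nabXi_rxi h, gm_smul_right, gm_rxi_right]; ring

lemma nabNabXi_self_rxi {α : Fin 3} (X : V) : 𝐐 α X (ξ α) = -𝐁 α (𝐁 α X) := by
  rw [nabNabXi, nabXi_rxi_self (ThreeQS.qs α), nab_zero_right, zero_sub]; rfl

lemma nabNabXi_rxi_self {α : Fin 3} (X : V) : 𝐐 α (ξ α) X = 0 := by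
  refine gm_ext F fun Y => ?_
  have hα := ThreeQS.qs (F := F) (V := V) α
  have h := gm_nabNabXi_eq hα X Y (ξ α)
  rw [gm_nabNabXi_skew hα Y, gm_nabNabXi_skew hα X, nabNabXi_self_rxi, nabNabXi_self_rxi,
    gm_neg_left, gm_neg_left, gm_nabXi_skew hα _ X, gm_nabXi_skew hα _ Y, gm_comm (𝐁 α Y)] at h
  rw [gm_zero_left]
  linear_combination h

lemma nabXi_commutator (h : Cyclic a b c) (X : V) :
    𝐁 c (𝐁 b X) - 𝐁 b (𝐁 c X) = (2 * κ) • 𝐁 a X - (κ ^ 2 * η c X) • ξ b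
      + (κ ^ 2 * η b X) • ξ c := by
  have ha := ThreeQS.qs (F := F) (V := V) a
  have hb := ThreeQS.qs (F := F) (V := V) b
  have hc := ThreeQS.qs (F := F) (V := V) c
  have e1 : ∀ X : V, 𝐐 c X (ξ b) = κ • 𝐁 a X - 𝐁 c (𝐁 b X) := fun X => by
    rw [nabNabXi, nabXi_rxi' h, nab_algebraMap_smul]; rfl
  have e2 : 𝐐 c (ξ b) X = (κ ^ 2 * η c X) • ξ b - (κ ^ 2 * η b X) • ξ c := by
    have hB : ∀ X : V, 𝐁 c X = φ a (𝐁 b X) + κ • η b X • ξ a := fun X => by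
      rw [ph_nabXi h]; module
    have h1 : 𝐃 (ξ b) (φ a (𝐁 b X)) = 𝐏 a (ξ b) (𝐁 b X) + φ a (𝐃 (ξ b) (𝐁 b X)) := by
      rw [nabPh]; abel
    have h2 : 𝐃 (ξ b) (𝐁 b X) = 𝐁 b (𝐃 (ξ b) X) := by
      have := nabNabXi_rxi_self (F := F) (α := b) X
      rwa [nabNabXi, sub_eq_zero] at this
    have h3 : 𝐃 (ξ b) (ξ a : V) = -κ • ξ c := nabXi_rxi h.rotate
    have h4 : 𝐠 (𝐁 a (φ a (𝐁 b X))) (ξ b) = 0 := by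
      rw [gm_nabXi_skew ha, nabXi_rxi h.rotate, gm_smul_right, gm_rxi_right,
        et_ph h.rotate.rotate, et_nabXi_self, mul_zero, neg_zero]
    rw [nabNabXi, hB, hB, nab_add_right, nab_algebraMap_smul, nab_smul_right, der_et,
      nabXi_rxi_self hb, gm_zero_right, h1, h2, h3, nabPh_eq ha, h4, et_nabXi h.rotate.rotate,
      nabXi_rxi h.rotate, ph_smul, ph_rxi' h.rotate.rotate]
    module
  refine gm_ext F fun Y => ?_
  have hQ := gm_nabNabXi_eq hc X Y (ξ b)
  rw [gm_nabNabXi_skew hc Y, gm_nabNabXi_skew hc X, e1, e1, e2] at hQ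
  simp only [gm_add_left, gm_sub_left, gm_smul_left] at hQ ⊢
  rw [gm_nabXi_skew ha Y, gm_nabXi_skew hc _ X, gm_nabXi_skew hb _ (𝐁 c X), gm_comm Y,
    gm_comm Y] at hQ
  linear_combination hQ

lemma nabXi_nabXi (h : Cyclic a b c) (X : V) :
    𝐁 a (𝐁 b X) = -φ c (𝐁 c (𝐁 c X)) + (κ ^ 2 * η b X) • ξ a := by
  have ha := ThreeQS.qs (F := F) (V := V) a
  have hB : ∀ Y : V, 𝐁 c Y = -φ b (𝐁 a Y) - (κ * η a Y) • ξ b := fun Y => by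
    rw [ph_nabXi' h]; abel
  rw [hB (𝐁 c X), ph_sub, ph_neg, ph_smul, ph_mul' h.rotate, ph_rxi' h.rotate,
    et_nabXi' h.rotate, et_nabXi_self, et_nabXi' h, ← nabXi_ph ha, ph_nabXi' h.rotate.rotate,
    nabXi_sub, nabXi_neg, nabXi_smul, nabXi_rxi_self ha]
  module

lemma nabXi_nabXi' (h : Cyclic a b c) (X : V) :
    𝐁 b (𝐁 a X) = φ c (𝐁 c (𝐁 c X)) + (κ ^ 2 * η a X) • ξ b := by
  have hb := ThreeQS.qs (F := F) (V := V) b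
  have hB : ∀ Y : V, 𝐁 c Y = φ a (𝐁 b Y) + (κ * η b Y) • ξ a := fun Y => by
    rw [ph_nabXi h]; abel
  rw [hB (𝐁 c X), ph_add, ph_smul, ph_mul h.rotate.rotate, ph_rxi h.rotate.rotate,
    et_nabXi h.rotate.rotate, et_nabXi_self, et_nabXi h, ← nabXi_ph hb, ph_nabXi h.rotate,
    nabXi_sub, nabXi_smul, nabXi_rxi_self hb]
  module

lemma ph_nabXi_nabXi (α : Fin 3) (X : V) : φ α (𝐁 α (𝐁 α X)) = κ • 𝐁 α X := by
  obtain ⟨a, b, h⟩ := exists_cyclic α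
  have h1 := nabXi_commutator (F := F) h X
  rw [nabXi_nabXi h.rotate, nabXi_nabXi' h.rotate] at h1
  refine gm_ext F fun Y => two_mul_cancel ?_
  have h2 := congrArg (𝐠 · Y) h1
  simp only [gm_add_left, gm_sub_left, gm_neg_left, gm_smul_left] at h2 ⊢
  linear_combination h2

lemma nabXi_nabXi_self (α : Fin 3) (X : V) : 𝐁 α (𝐁 α X) = -κ • φ α (𝐁 α X) := by
  have h := congrArg (φ α) (ph_nabXi_nabXi (F := F) α X)
  rw [ph_ph, et_nabXi_self, zero_smul, add_zero, ph_smul] at h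
  rw [neg_smul, ← h, neg_neg]

lemma nabXi_pow_four (α : Fin 3) (X : V) :
    𝐁 α (𝐁 α (𝐁 α (𝐁 α X))) = -κ ^ 2 • 𝐁 α (𝐁 α X) := by
  have hα := ThreeQS.qs (F := F) (V := V) α
  rw [nabXi_nabXi_self α (𝐁 α (𝐁 α X)), ← nabXi_ph hα, ph_nabXi_nabXi, nabXi_smul]
  module

lemma nabXi_nabXi_rxi (h : Cyclic a b c) : 𝐁 a (𝐁 a (ξ b : V)) = -κ ^ 2 • ξ b := by
  rw [nabXi_rxi h.rotate, nabXi_smul, nabXi_rxi' h.rotate]; module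

lemma nabXi_nabXi_eq_zero (hc : cc F V = 0) (α β : Fin 3) (X : V) : 𝐁 α (𝐁 β X) = 0 := by
  have hs : ∀ α (X : V), 𝐁 α (𝐁 α X) = 0 := fun α X => by simp [nabXi_nabXi_self, hc]
  obtain ⟨b, c, h⟩ := exists_cyclic α
  obtain rfl | rfl | rfl := h.eq_or β
  · exact hs _ X
  · simp [nabXi_nabXi h, hs, hc, ph_zero]
  · simp [nabXi_nabXi' h.rotate.rotate, hs, hc, ph_zero]

lemma et_nabXi_eq_zero (hc : cc F V = 0) (α β : Fin 3) (X : V) : η α (𝐁 β X) = 0 := by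
  obtain ⟨b, c, h⟩ := exists_cyclic α
  obtain rfl | rfl | rfl := h.eq_or β
  · exact et_nabXi_self _ X
  · simp [et_nabXi h.rotate.rotate, hc]
  · simp [et_nabXi' h, hc]

/-- A 3-quasi-Sasakian structure whose Reeb vector fields commute has parallel Reeb vector
fields. -/
lemma nabXi_eq_zero_of_cc_eq_zero (hc : cc F V = 0) (α : Fin 3) (X : V) : 𝐁 α X = 0 := by
  have hE : InE4m F V (𝐁 α X) := by
    refine ⟨fun β => et_nabXi_eq_zero hc β α X, fun β Y => two_mul_cancel ?_⟩
    rw [two_mul_dOne_et, gm_nabXi_skew (ThreeQS.qs β) Y, nabXi_nabXi_eq_zero hc]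
    simp [gm_zero_left, gm_zero_right]
  refine gm_ext F fun Y => ?_
  obtain ⟨Yl, Ym, hl, hm, hYe⟩ := ThreeQS.horiz_split _ (horiz_horComp (F := F) Y)
  have hB : 𝐁 α Ym = 0 := by
    refine gm_ext F fun Z => two_mul_cancel ?_
    have h := two_mul_dOne_et (F := F) α Ym Z
    rw [hm.2, gm_nabXi_skew (ThreeQS.qs α) Z, gm_comm Z] at h
    rw [gm_zero_left]
    linear_combination -h
  have h1 : 𝐠 (𝐁 α X) (horComp F V Y) = 𝐠 (𝐁 α X) Y := by
    simp [horComp, Fin.sum_univ_three, gm_sub_right, gm_add_right, gm_smul_right, gm_rxi_right,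
      et_nabXi_eq_zero hc]
  rw [← h1, hYe, gm_add_right, gm_nabXi_skew (ThreeQS.qs α) X Ym, hB, gm_comm, hl.2 _ hE,
    gm_zero_left, gm_zero_right, neg_zero, add_zero]

lemma Ric_rxi_rxi (α : Fin 3) :
    Ric F V (ξ α) (ξ α) = -∑ i, 𝐠 (𝐁 α (𝐁 α (fr F V i))) (fr F V i) := by
  simp [Ric, Rcurv_rxi, nabNabXi_self_rxi, nabNabXi_rxi_self, gm_neg_left]

/-- The trace condition `Ric(ξ_α, ξ_α) = 0` rules out a nonzero Reeb constant: up to a factor,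
`(∇ξ_α)²` is idempotent, and it fixes the remaining Reeb vector fields. -/
lemma cc_eq_zero_of_Ric_rxi_rxi [Nontrivial F] {α : Fin 3} (h : Ric F V (ξ α) (ξ α) = 0) :
    cc F V = 0 := by
  by_contra hc
  obtain ⟨β, γ, hβ⟩ := exists_cyclic α
  obtain ⟨m, hm⟩ := Ideal.exists_maximal F
  let := Ideal.Quotient.field m
  let f := Ideal.Quotient.mk m
  have : CharZero (F ⧸ m) := 
    charZero_of_injective_algebraMap (algebraMap ℝ (F ⧸ m)).injective
  let l : F := algebraMap ℝ F (-((cc F V / 2) ^ 2)⁻¹)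
  have hl : l * -κ ^ 2 = 1 := by
    rw [← map_pow, ← map_neg, ← map_mul, ← map_one (algebraMap ℝ F)]
    congr 1
    field_simp
  let B : V →ₗ[F] V :=
    { toFun := fun X => l • 𝐁 α (𝐁 α X)
      map_add' := fun X Y => by simp only [nabXi_add, smul_add]
      map_smul' := fun r X => by simp only [nabXi_smul, RingHom.id_apply, smul_comm r] }
  have hB : ∀ X, B (B X) = B X := fun X => by
    change l • 𝐁 α (𝐁 α (l • 𝐁 α (𝐁 α X))) = l • 𝐁 α (𝐁 α X)
    rw [nabXi_smul, nabXi_smul, nabXi_pow_four, smul_smul l (-κ ^ 2), hl, one_smul]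
  have hBβ : B (ξ β) = ξ β := by
    change l • 𝐁 α (𝐁 α (ξ β)) = ξ β
    rw [nabXi_nabXi_rxi hβ, smul_smul, hl, one_smul]
  have hexp : ∀ X Y, 𝐠 (B X) Y = ∑ j, 𝐠 (B (fr F V j)) Y * 𝐠 X (fr F V j) := fun X Y => by
    conv_lhs => rw [eq_sum_fr F X]
    simp only [map_sum, map_smul, gm_sum_left, gm_smul_left, mul_comm]
  let M : Matrix (Fin (4 * dimn F V + 3)) (Fin (4 * dimn F V + 3)) (F ⧸ m) :=
    Matrix.of fun i j => f (𝐠 (B (fr F V j)) (fr F V i))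
  have hM : IsIdempotentElem (Matrix.toLin' M) := by
    rw [IsIdempotentElem, Module.End.mul_eq_comp, ← Matrix.toLin'_mul]
    congr 1
    ext i j
    simp only [M, Matrix.mul_apply, Matrix.of_apply, ← map_mul, ← map_sum]
    rw [← hexp, hB]
  have htr : LinearMap.trace (F ⧸ m) _ (Matrix.toLin' M) = 0 := by
    rw [Matrix.trace_toLin'_eq]
    rw [Ric_rxi_rxi, neg_eq_zero] at h
    simp only [Matrix.trace, Matrix.diag, M, Matrix.of_apply, ← map_sum]
    change f (∑ i, 𝐠 (l • 𝐁 α (𝐁 α (fr F V i))) (fr F V i)) = 0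
    simp only [gm_smul_left, ← Finset.mul_sum, h, mul_zero, map_zero]
  have hM0 : M = 0 := by
    simpa using LinearMap.IsIdempotentElem.eq_zero_of_trace_eq_zero hM htr
  have hv : ∀ i, f (𝐠 (ξ β) (fr F V i)) = 0 := fun i => by
    rw [← hBβ, hexp, map_sum]
    refine Finset.sum_eq_zero fun j _ => ?_
    have := congrFun (congrFun hM0 i) j
    simp only [M, Matrix.of_apply, Matrix.zero_apply] at this
    rw [map_mul, this, zero_mul]
  have h1 := congrArg f (et_rxi_self (F := F) (V := V) β)
  rw [← gm_rxi_right, eq_sum_fr F (ξ β), gm_sum_left, map_sum] at h1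
  simp only [gm_smul_left, map_mul, hv, zero_mul, Finset.sum_const_zero, map_one] at h1
  exact zero_ne_one h1

end ThreeQuasiSasakian

section ParallelReeb

lemma Rcurv_rxi_eq_zero (hB : ∀ (α : Fin 3) (X : V), 𝐁 α X = 0) (α : Fin 3) (X Y : V) :
    𝐑 X Y (ξ α) = 0 := by
  simp [Rcurv_rxi, nabNabXi, hB, nab_zero_right]

lemma et_Rcurv (hB : ∀ (α : Fin 3) (X : V), 𝐁 α X = 0) (α : Fin 3) (X Y Z : V) :
    η α (𝐑 X Y Z) = 0 := by
  rw [← gm_rxi_right, gm_Rcurv_skew, Rcurv_rxi_eq_zero hB, gm_zero_left, neg_zero]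

variable [ThreeQS F V]

lemma Rcurv_ph (hB : ∀ (α : Fin 3) (X : V), 𝐁 α X = 0) (α : Fin 3) (X Y Z : V) :
    𝐑 X Y (φ α Z) = φ α (𝐑 X Y Z) := by
  have h : ∀ X Y : V, 𝐃 X (φ α Y) = φ α (𝐃 X Y) := fun X Y => by
    rw [← sub_eq_zero]
    change 𝐏 α X Y = 0
    simp [nabPh_eq (ThreeQS.qs α), hB, gm_zero_left, ph_zero]
  simp only [Rcurv, h, ph_sub]

lemma gm_Rcurv_ph_ph (hB : ∀ (α : Fin 3) (X : V), 𝐁 α X = 0) (α : Fin 3) (X Y Z W : V) :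
    𝐠 (𝐑 X Y (φ α Z)) (φ α W) = 𝐠 (𝐑 X Y Z) W := by
  rw [Rcurv_ph hB, gm_ph_ph, et_Rcurv hB, zero_mul, sub_zero]

lemma gm_Rcurv_ph (hB : ∀ (α : Fin 3) (X : V), 𝐁 α X = 0) (α : Fin 3) (X Y Z W : V) :
    𝐠 (𝐑 X Y (φ α Z)) W = -𝐠 (𝐑 X Y Z) (φ α W) := by
  rw [Rcurv_ph hB, gm_ph_left]

lemma gm_Rcurv_ph_left (hB : ∀ (α : Fin 3) (X : V), 𝐁 α X = 0) (α : Fin 3) (X Y Z W : V) :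
    𝐠 (𝐑 (φ α X) Y Z) W = -𝐠 (𝐑 X (φ α Y) Z) W := by
  rw [gm_Rcurv_pair_comm, gm_Rcurv_ph hB, gm_Rcurv_pair_comm]

lemma sum_gm_Rcurv_fr_ph (hB : ∀ (α : Fin 3) (X : V), 𝐁 α X = 0) (α : Fin 3) (X Y : V) :
    ∑ i, 𝐠 (𝐑 X Y (fr F V i)) (φ α (fr F V i)) = 0 := by
  obtain ⟨b, c, h⟩ := exists_cyclic α
  let T : V →ₗ[F] V →ₗ[F] F := LinearMap.mk₂ F (fun Z W => 𝐠 (𝐑 X Y Z) (φ α W))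
    (fun Z Z' W => by simp only [gm_Rcurv_skew X Y _ (φ α W), gm_add_right]; ring)
    (fun r Z W => by simp only [gm_Rcurv_skew X Y _ (φ α W), gm_smul_right, smul_eq_mul]; ring)
    (fun Z W W' => by simp only [ph_add, gm_add_right])
    (fun r Z W => by simp only [ph_smul, gm_smul_right, smul_eq_mul])
  have hT := sum_bilin_ph_ph T b
  simp only [T, LinearMap.mk₂_apply] at hT
  have key : ∀ Z : V, 𝐠 (𝐑 X Y (φ b Z)) (φ α (φ b Z)) = -𝐠 (𝐑 X Y Z) (φ α Z) := fun Z => by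
    have h1 : φ α (φ b Z) = -φ b (φ α Z) + η b Z • ξ α + η α Z • ξ b := by
      rw [ph_mul h, ph_mul' h]; module
    simp only [h1, gm_add_right, gm_neg_right, gm_smul_right, gm_rxi_right, et_Rcurv hB,
      gm_Rcurv_ph_ph hB, mul_zero, add_zero]
  simp only [key, Finset.sum_neg_distrib, Rcurv_rxi_eq_zero hB, gm_zero_left, sub_zero] at hT
  exact two_mul_cancel (by linear_combination -hT)

lemma Ric_ph_ph (hB : ∀ (α : Fin 3) (X : V), 𝐁 α X = 0) (α : Fin 3) (X Y : V) :
    Ric F V (φ α X) (φ α Y) = Ric F V X Y := by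
  let T : V →ₗ[F] V →ₗ[F] F := LinearMap.mk₂ F (fun Z W => 𝐠 (𝐑 Z X Y) W)
    (fun Z Z' W => by simp only [fun Z => gm_Rcurv_eq_neg (F := F) Z X Y W, gm_add_right]; ring)
    (fun r Z W => by
      simp only [fun Z => gm_Rcurv_eq_neg (F := F) Z X Y W, gm_smul_right, smul_eq_mul]; ring)
    (fun Z W W' => by simp only [gm_add_right])
    (fun r Z W => by simp only [gm_smul_right, smul_eq_mul])
  have hT := sum_bilin_ph_ph T α
  simp only [T, LinearMap.mk₂_apply, gm_rxi_right, et_Rcurv hB, sub_zero] at hT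
  rw [Ric, Ric, ← hT]
  refine Finset.sum_congr rfl fun i _ => ?_
  rw [gm_Rcurv_ph_left hB, gm_Rcurv_ph hB]

lemma Ric_eq_zero (hB : ∀ (α : Fin 3) (X : V), 𝐁 α X = 0) (X Y : V) : Ric F V X Y = 0 := by
  have key : ∀ Z : V, 𝐠 (𝐑 Z X Y) Z =
      -𝐠 (𝐑 X (φ 0 Y) Z) (φ 0 Z) - 𝐠 (𝐑 Z (φ 0 Y) (φ 0 X)) Z := fun Z => by
    have h1 := congrArg (𝐠 · (φ 0 Z)) (Rcurv_bianchi (F := F) Z X (φ 0 Y))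
    have h2 : 𝐠 (𝐑 (φ 0 Y) Z X) (φ 0 Z) = 𝐠 (𝐑 Z (φ 0 Y) (φ 0 X)) Z := by
      rw [Rcurv_ph hB, gm_ph_left, Rcurv_antisymm, gm_neg_left]
    simp only [gm_add_left, gm_zero_left, gm_Rcurv_ph_ph hB, h2] at h1
    linear_combination h1
  have hS : Ric F V X Y = -Ric F V (φ 0 Y) (φ 0 X) := by
    simp only [Ric, key, Finset.sum_sub_distrib, Finset.sum_neg_distrib, sum_gm_Rcurv_fr_ph hB]
    ring
  have hsymm : Ric F V Y X = Ric F V X Y := by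
    refine Finset.sum_congr rfl fun i _ => ?_
    rw [gm_Rcurv_pair_comm, Rcurv_antisymm, gm_neg_left, gm_Rcurv_skew, neg_neg]
  rw [Ric_ph_ph hB, hsymm] at hS
  exact two_mul_cancel (by linear_combination hS)

end ParallelReeb

end LeviCivitaConnection

/-- A 3-quasi-Sasakian manifold is Ricci-flat if and only if it is
3-cosymplectic. -/
theorem ricciFlat_iff_threeCosymplectic (F V : Type) [CommRing F] [Algebra ℝ F] [AddCommGroup V] [Module F V]
    [SmoothSetting F V] [ACM3 F V] [ThreeQS F V] [LeviCivita F V] :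
    (∀ X Y : V, Ric F V X Y = 0) ↔ ThreeCosymplectic F V := by
  have two_mul_dOne : ∀ (α : Fin 3) (X Y : V),
      2 * dOne F V (et F V α) X Y = 2 * gm F V (nabXi F V α X) Y := fun α X Y => by
    rw [two_mul_dOne_et, gm_nabXi_skew (ThreeQS.qs α) Y, gm_comm Y]; ring
  constructor
  · intro h α
    refine ⟨(ThreeQS.qs α).1, fun X Y => ?_, (ThreeQS.qs α).2⟩
    rcases subsingleton_or_nontrivial F with hF | hF
    · exact Subsingleton.elim _ _
    · rw [two_mul_cancel (two_mul_dOne α X Y),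
        nabXi_eq_zero_of_cc_eq_zero (cc_eq_zero_of_Ric_rxi_rxi (h (rxi F V α) _)), gm_zero_left]
  · intro h
    refine Ric_eq_zero fun α X => gm_ext F fun Y => ?_
    rw [← two_mul_cancel (two_mul_dOne α X Y), (h α).2.1, gm_zero_left]

end QS3
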